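/- Let X be a completely metrizable topological space and F a nonempty closed subset of X such that the subspace X \ F is ultranormal. Then there exists a map Ξ : Met(F) → Met(X) satisfying properties (1)–(4) (extension, sup-distance isometry, monotonicity, and compatibility with pointwise maxima) and, in addition, Ξ maps every complete metric in Met(F) to a complete metric in Met(X). -/

import Mathlib

open Filter

/-- A topological space is *ultranormal* if every pair of disjoint closed sets can be
separated by a clopen set. -/
def Ultranormal (X : Type*) [TopologicalSpace X] : Prop :=
  ∀ A B : Set X, IsClosed A → IsClosed B → Disjoint A B →
    ∃ C : Set X, IsClopen C ∧ A ⊆ C ∧ Disjoint C B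

/-- `d` belongs to `Met(Y)`: it is a metric on `Y` (as a bare function) whose metric
topology coincides with the given topology of `Y`. -/
def IsCompatMetric (Y : Type*) [TopologicalSpace Y] (d : Y → Y → ℝ) : Prop :=
  (∀ x y, 0 ≤ d x y) ∧ (∀ x y, d x y = d y x) ∧
  (∀ x y z, d x z ≤ d x y + d y z) ∧ (∀ x y, d x y = 0 ↔ x = y) ∧
  (∀ x : Y, ∀ s : Set Y, s ∈ nhds x ↔ ∃ ε > 0, {y : Y | d x y < ε} ⊆ s)

/-- A metric (as a bare function) is complete if every Cauchy sequence converges. -/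
def IsCompleteMetricFun {Y : Type*} (d : Y → Y → ℝ) : Prop :=
  ∀ x : ℕ → Y, (∀ ε : ℝ, 0 < ε → ∃ N : ℕ, ∀ m ≥ N, ∀ n ≥ N, d (x m) (x n) < ε) →
    ∃ l : Y, Tendsto (fun n => d (x n) l) atTop (nhds 0)

open Topology Set

/-- In a paracompact ultranormal space, every open cover is subordinated by a locally constant
choice of a member of the cover. -/
theorem Ultranormal.exists_isLocallyConstant_mem {Y ι : Type*} [TopologicalSpace Y] [T2Space Y]
    [ParacompactSpace Y] (hY : Ultranormal Y) (u : ι → Set Y) (uo : ∀ i, IsOpen (u i))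
    (uc : ⋃ i, u i = univ) : ∃ f : Y → ι, IsLocallyConstant f ∧ ∀ y, y ∈ u (f y) := by
  obtain ⟨v, vo, vc, vf, vu⟩ := precise_refinement u uo uc
  obtain ⟨w, wc, wcl, wv⟩ := exists_iUnion_eq_closed_subset vo vf.point_finite vc
  have hsep : ∀ i, ∃ C : Set Y, IsClopen C ∧ w i ⊆ C ∧ Disjoint C (v i)ᶜ := fun i ↦
    hY _ _ (wcl i) (vo i).isClosed_compl (disjoint_compl_right_iff_subset.2 (wv i))
  choose C hC hwC hCv using hsep
  have hCv' : ∀ i, C i ⊆ v i := fun i ↦ disjoint_compl_right_iff_subset.1 (hCv i)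
  have hCf : LocallyFinite C := vf.subset hCv'
  have hne : ∀ y, {i | y ∈ C i}.Nonempty := fun y ↦ by
    obtain ⟨i, hi⟩ := mem_iUnion.1 (wc.symm ▸ mem_univ y : y ∈ ⋃ i, w i)
    exact ⟨i, hwC i hi⟩
  obtain ⟨_, _⟩ := exists_wellFoundedLT ι
  have hwf : WellFounded ((· < ·) : ι → ι → Prop) := wellFounded_lt
  refine ⟨fun y ↦ hwf.min _ (hne y), ?_, fun y ↦ vu _ (hCv' _ (hwf.min_mem _ (hne y)))⟩
  refine (IsLocallyConstant.iff_eventually_eq _).2 fun x ↦ ?_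
  filter_upwards [hCf.eventually_subset (fun i ↦ (hC i).1) x,
    (hC _).2.mem_nhds (hwf.min_mem _ (hne x))] with y hsub hy
  exact le_antisymm (not_lt.1 (hwf.not_lt_min _ hy))
    (not_lt.1 (hwf.not_lt_min _ (hsub (hwf.min_mem _ (hne y)))))

/-- A nonempty closed set with ultranormal complement is a retract, by a retraction which moves
each point at most twice its distance to the set. -/
theorem exists_retraction_dist_le {X : Type*} [MetricSpace X] {F : Set X} (hne : F.Nonempty)
    (hF : IsClosed F) (hun : Ultranormal ↥(Fᶜ)) :
    ∃ r : X → F, Continuous r ∧ (∀ a : F, r a = a) ∧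
      ∀ x : X, dist x (r x : X) ≤ 2 * Metric.infDist x F := by
  classical
  have hpos : ∀ x : ↥(Fᶜ), 0 < Metric.infDist (x : X) F := fun x ↦
    (hF.notMem_iff_infDist_pos hne).1 x.2
  obtain ⟨f, hf, hfu⟩ := hun.exists_isLocallyConstant_mem
    (fun q : F ↦ {x : ↥(Fᶜ) | dist (x : X) q < 2 * Metric.infDist (x : X) F})
    (fun q ↦ isOpen_lt (by fun_prop)
      (continuous_const.mul ((Metric.continuous_infDist_pt F).comp continuous_subtype_val)))
    (by
      refine iUnion_eq_univ_iff.2 fun x ↦ ?_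
      obtain ⟨q, hq, hxq⟩ := (Metric.infDist_lt_iff hne).1
        (show Metric.infDist (x : X) F < 2 * Metric.infDist (x : X) F by linarith [hpos x])
      exact ⟨⟨q, hq⟩, hxq⟩)
  let r : X → F := fun x ↦ if h : x ∈ F then ⟨x, h⟩ else f ⟨x, h⟩
  have hrF : ∀ a : F, r a = a := fun a ↦ by simp [r]
  have hrd : ∀ x : X, dist x (r x : X) ≤ 2 * Metric.infDist x F := fun x ↦ by
    by_cases h : x ∈ F
    · simp [r, h, Metric.infDist_nonneg]
    · simpa [r, h] using (hfu ⟨x, h⟩).le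
  refine ⟨r, continuous_iff_continuousAt.2 fun x ↦ ?_, hrF, hrd⟩
  by_cases h : x ∈ F
  · rw [ContinuousAt, tendsto_iff_dist_tendsto_zero]
    have hlim : Tendsto (fun y ↦ 3 * dist y x) (𝓝 x) (𝓝 0) := by
      have : Continuous fun y ↦ 3 * dist y x := by fun_prop
      simpa using this.tendsto x
    refine squeeze_zero (fun _ ↦ dist_nonneg) (fun y ↦ ?_) hlim
    have h₁ := Metric.infDist_le_dist_of_mem (x := y) h
    have h₂ := dist_triangle_left (r y : X) x y
    have h₃ := hrd y
    rw [Subtype.dist_eq, show (r x : X) = x from congrArg Subtype.val (hrF ⟨x, h⟩)]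
    linarith
  · have hcomp : Fᶜ.domRestrict r = f := funext fun y ↦ dif_neg y.2
    have hcont : ContinuousOn r Fᶜ := by
      rw [continuousOn_iff_continuous_domRestrict]
      exact hcomp ▸ hf.continuous
    exact hcont.continuousAt (hF.isOpen_compl.mem_nhds h)

theorem nhds_eq_comap_iff_of_nonneg {Y : Type*} [TopologicalSpace Y] {x : Y} {g : Y → ℝ}
    (hg : ∀ y, 0 ≤ g y) :
    (∀ s : Set Y, s ∈ 𝓝 x ↔ ∃ ε > 0, {y : Y | g y < ε} ⊆ s) ↔ 𝓝 x = comap g (𝓝 0) := by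
  have hb : (comap g (𝓝 0)).HasBasis (fun ε : ℝ ↦ 0 < ε) fun ε ↦ {y | g y < ε} := by
    refine (Metric.nhds_basis_ball.comap g).congr (fun _ ↦ Iff.rfl) fun ε _ ↦ ?_
    ext y
    simp [abs_of_nonneg (hg y)]
  constructor
  · intro h
    ext s
    rw [h, hb.mem_iff]
  · intro h s
    rw [h, hb.mem_iff]

theorem IsCompatMetric.nhds_eq_comap {Y : Type*} [TopologicalSpace Y] {d : Y → Y → ℝ}
    (hd : IsCompatMetric Y d) (x : Y) : 𝓝 x = comap (d x) (𝓝 0) :=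
  (nhds_eq_comap_iff_of_nonneg (hd.1 x)).1 (hd.2.2.2.2 x)

theorem IsCompatMetric.tendsto_nhds_iff {Y α : Type*} [TopologicalSpace Y] {d : Y → Y → ℝ}
    (hd : IsCompatMetric Y d) {l : Filter α} {g : α → Y} {a : Y} :
    Tendsto g l (𝓝 a) ↔ Tendsto (fun n ↦ d a (g n)) l (𝓝 0) := by
  rw [hd.nhds_eq_comap a, tendsto_comap_iff]
  rfl

/-- The pseudometric obtained from the distance by collapsing the set `F` to a point. -/
noncomputable def collapseDist {X : Type*} [MetricSpace X] (F : Set X) (x y : X) : ℝ :=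
  min (dist x y) (Metric.infDist x F + Metric.infDist y F)

section collapseDist

variable {X : Type*} [MetricSpace X] {F : Set X}

theorem collapseDist_nonneg (x y : X) : 0 ≤ collapseDist F x y :=
  le_min dist_nonneg (add_nonneg Metric.infDist_nonneg Metric.infDist_nonneg)

theorem collapseDist_comm (x y : X) : collapseDist F x y = collapseDist F y x := by
  rw [collapseDist, collapseDist, dist_comm, add_comm]

theorem collapseDist_le_dist (x y : X) : collapseDist F x y ≤ dist x y := min_le_left _ _

theorem collapseDist_of_mem {x y : X} (hx : x ∈ F) (hy : y ∈ F) : collapseDist F x y = 0 := by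
  simp [collapseDist, Metric.infDist_zero_of_mem hx, Metric.infDist_zero_of_mem hy]

theorem infDist_sub_le_collapseDist (x y : X) :
    Metric.infDist y F - Metric.infDist x F ≤ collapseDist F x y := by
  have h := Metric.infDist_le_infDist_add_dist (s := F) (x := y) (y := x)
  have hx := Metric.infDist_nonneg (x := x) (s := F)
  rw [dist_comm] at h
  exact le_min (by linarith) (by linarith)

theorem collapseDist_triangle (x y z : X) :
    collapseDist F x z ≤ collapseDist F x y + collapseDist F y z := by
  have hx := infDist_sub_le_collapseDist (F := F) y x
  have hz := infDist_sub_le_collapseDist (F := F) y z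
  rw [collapseDist_comm] at hx
  rcases min_choice (dist x y) (Metric.infDist x F + Metric.infDist y F) with h₁ | h₁ <;>
  rcases min_choice (dist y z) (Metric.infDist y F + Metric.infDist z F) with h₂ | h₂ <;>
  rw [← collapseDist] at h₁ h₂
  · rw [h₁, h₂]
    exact (collapseDist_le_dist _ _).trans (dist_triangle _ _ _)
  all_goals
    refine (min_le_right _ _).trans ?_
    have hy := Metric.infDist_nonneg (x := y) (s := F)
    linarith

/-- Away from `F`, a small collapsed distance is the original distance. -/
theorem dist_lt_of_collapseDist_lt {x y : X} {ε : ℝ} (h : collapseDist F x y < ε)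
    (hε : ε ≤ Metric.infDist x F) : dist x y < ε := by
  rcases min_lt_iff.1 h with h | h
  · exact h
  · linarith [Metric.infDist_nonneg (x := y) (s := F)]

theorem tendsto_collapseDist (x : X) : Tendsto (collapseDist F x) (𝓝 x) (𝓝 0) := by
  refine squeeze_zero (collapseDist_nonneg x) (collapseDist_le_dist x) ?_
  have : Continuous fun y ↦ dist x y := by fun_prop
  simpa using this.tendsto x

end collapseDist

/-- Extend a function `d` on `F × F` to `X × X` by pulling it back along `r : X → F` and adding
the collapsed distance. -/
noncomputable def metricExtension {X : Type*} [MetricSpace X] {F : Set X} (r : X → F)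
    (d : F → F → ℝ) (x y : X) : ℝ :=
  d (r x) (r y) + collapseDist F x y

section metricExtension

variable {X : Type*} [MetricSpace X] {F : Set X} {r : X → F} {d : F → F → ℝ}

theorem tendsto_of_tendsto_retraction {α : Type*} {l : Filter α} {g : α → X} {a : F}
    (hr : ∀ x : X, dist x (r x : X) ≤ 2 * Metric.infDist x F)
    (hg : Tendsto (fun n ↦ Metric.infDist (g n) F) l (𝓝 0))
    (hrg : Tendsto (fun n ↦ r (g n)) l (𝓝 a)) : Tendsto g l (𝓝 (a : X)) := by
  rw [tendsto_iff_dist_tendsto_zero] at hrg ⊢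
  have hlim := (hg.const_mul 2).add hrg
  rw [mul_zero, add_zero] at hlim
  refine squeeze_zero (fun _ ↦ dist_nonneg) (fun n ↦ ?_) hlim
  have h := dist_triangle (g n) (r (g n)) (a : X)
  have h' := hr (g n)
  rw [Subtype.dist_eq]
  linarith

theorem isCompatMetric_metricExtension (hF : IsClosed F) (hne : F.Nonempty) (hrc : Continuous r)
    (hrF : ∀ a : F, r a = a) (hr : ∀ x : X, dist x (r x : X) ≤ 2 * Metric.infDist x F)
    (hd : IsCompatMetric F d) : IsCompatMetric X (metricExtension r d) := by
  have hnhds : ∀ x, 𝓝 x = comap (metricExtension r d x) (𝓝 0) := by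
    intro x
    refine le_antisymm (tendsto_iff_comap.1 ?_) ?_
    · have h := (hd.tendsto_nhds_iff.1 (hrc.tendsto x)).add (tendsto_collapseDist (F := F) x)
      rwa [add_zero] at h
    · have hsum : Tendsto (metricExtension r d x) (comap (metricExtension r d x) (𝓝 0)) (𝓝 0) :=
        tendsto_comap
      have hc : Tendsto (collapseDist F x) (comap (metricExtension r d x) (𝓝 0)) (𝓝 0) :=
        squeeze_zero (collapseDist_nonneg x)
          (fun y ↦ le_add_of_nonneg_left (hd.1 (r x) (r y))) hsum
      suffices h : Tendsto id (comap (metricExtension r d x) (𝓝 0)) (𝓝 x) from h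
      by_cases hx : x ∈ F
      · refine tendsto_of_tendsto_retraction (a := ⟨x, hx⟩) hr ?_ ?_
        · refine squeeze_zero (fun _ ↦ Metric.infDist_nonneg) (fun y ↦ ?_) hc
          simpa [Metric.infDist_zero_of_mem hx] using infDist_sub_le_collapseDist (F := F) x y
        · rw [hd.tendsto_nhds_iff]
          refine squeeze_zero (fun _ ↦ hd.1 _ _) (fun y ↦ ?_) hsum
          rw [metricExtension, show r x = ⟨x, hx⟩ from hrF ⟨x, hx⟩]
          exact le_add_of_nonneg_right (collapseDist_nonneg x y)
      · have hpos := (hF.notMem_iff_infDist_pos hne).1 hx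
        refine Metric.tendsto_nhds.2 fun ε hε ↦ ?_
        filter_upwards [hc.eventually_lt_const (lt_min hε hpos)] with y hy
        rw [id, dist_comm]
        exact (dist_lt_of_collapseDist_lt hy (min_le_right _ _)).trans_le (min_le_left _ _)
  have hnonneg : ∀ x y, 0 ≤ metricExtension r d x y := fun x y ↦
    add_nonneg (hd.1 _ _) (collapseDist_nonneg x y)
  refine ⟨hnonneg, fun x y ↦ ?_, fun x y z ↦ ?_, fun x y ↦ ⟨fun h ↦ ?_, ?_⟩,
    fun x ↦ (nhds_eq_comap_iff_of_nonneg (hnonneg x)).2 (hnhds x)⟩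
  · rw [metricExtension, metricExtension, hd.2.1, collapseDist_comm]
  · have h₁ := hd.2.2.1 (r x) (r y) (r z)
    have h₂ := collapseDist_triangle (F := F) x y z
    simp only [metricExtension]
    linarith
  · have hpure : Tendsto (fun _ : Unit ↦ y) ⊤ (𝓝 x) := by
      rw [hnhds x, tendsto_comap_iff]
      simp [Function.comp_def, h]
    exact tendsto_nhds_unique hpure tendsto_const_nhds
  · rintro rfl
    simp [metricExtension, (hd.2.2.2.1 (r x) (r x)).2 rfl, collapseDist, Metric.infDist_nonneg]

theorem isCompleteMetricFun_metricExtension [CompleteSpace X] (hF : IsClosed F)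
    (hne : F.Nonempty) (hrc : Continuous r) (hrF : ∀ a : F, r a = a)
    (hr : ∀ x : X, dist x (r x : X) ≤ 2 * Metric.infDist x F)
    (hd : IsCompatMetric F d) (hdc : IsCompleteMetricFun d) :
    IsCompleteMetricFun (metricExtension r d) := by
  have hcompat := isCompatMetric_metricExtension hF hne hrc hrF hr hd
  intro x hx
  suffices h : ∃ l, Tendsto x atTop (𝓝 l) by
    obtain ⟨l, hl⟩ := h
    refine ⟨l, ?_⟩
    simpa only [hcompat.2.1 l] using hcompat.tendsto_nhds_iff.1 hl
  have hxd : ∀ ε : ℝ, 0 < ε → ∃ N : ℕ, ∀ m ≥ N, ∀ n ≥ N, d (r (x m)) (r (x n)) < ε :=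
    fun ε hε ↦ (hx ε hε).imp fun N hN m hm n hn ↦
      (le_add_of_nonneg_right (collapseDist_nonneg _ _)).trans_lt (hN m hm n hn)
  have hxc : ∀ ε : ℝ, 0 < ε → ∃ N : ℕ, ∀ m ≥ N, ∀ n ≥ N, collapseDist F (x m) (x n) < ε :=
    fun ε hε ↦ (hx ε hε).imp fun N hN m hm n hn ↦
      (le_add_of_nonneg_left (hd.1 _ _)).trans_lt (hN m hm n hn)
  have hcauchy : CauchySeq fun n ↦ Metric.infDist (x n) F := by
    refine Metric.cauchySeq_iff.2 fun ε hε ↦ (hxc ε hε).imp fun N hN m hm n hn ↦ ?_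
    have h₁ := (infDist_sub_le_collapseDist (F := F) (x n) (x m)).trans_lt (hN n hn m hm)
    have h₂ := (infDist_sub_le_collapseDist (F := F) (x m) (x n)).trans_lt (hN m hm n hn)
    rw [Real.dist_eq, abs_lt]
    constructor <;> linarith
  obtain ⟨c, hc⟩ := cauchySeq_tendsto_of_complete hcauchy
  rcases (ge_of_tendsto' hc fun _ ↦ Metric.infDist_nonneg).eq_or_lt with rfl | hpos
  · obtain ⟨l, hl⟩ := hdc (fun n ↦ r (x n)) hxd
    refine ⟨l, tendsto_of_tendsto_retraction hr hc (hd.tendsto_nhds_iff.2 ?_)⟩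
    simpa only [hd.2.1 l] using hl
  · obtain ⟨M, hM⟩ := eventually_atTop.1 (hc.eventually_const_lt (half_lt_self hpos))
    refine cauchySeq_tendsto_of_complete (Metric.cauchySeq_iff.2 fun ε hε ↦ ?_)
    obtain ⟨N, hN⟩ := hxc (min ε (c / 2)) (lt_min hε (half_pos hpos))
    refine ⟨max M N, fun m hm n hn ↦ ?_⟩
    exact (dist_lt_of_collapseDist_lt (hN m (le_of_max_le_right hm) n (le_of_max_le_right hn))
      ((min_le_right _ _).trans (hM m (le_of_max_le_left hm)).le)).trans_le (min_le_left _ _)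

end metricExtension

theorem exists_metricSpace_of_isCompatMetric {X : Type*} [t : TopologicalSpace X]
    {d : X → X → ℝ} (hd : IsCompatMetric X d) (hdc : IsCompleteMetricFun d) :
    ∃ m : MetricSpace X, m.toPseudoMetricSpace.toUniformSpace.toTopologicalSpace = t ∧
      CompleteSpace X := by
  let m : MetricSpace X := MetricSpace.ofDistTopology d (fun x ↦ (hd.2.2.2.1 x x).2 rfl) hd.2.1
    hd.2.2.1 (fun s ↦ by simp only [isOpen_iff_mem_nhds, hd.2.2.2.2, subset_def, mem_ofPred_eq])
    (fun x y ↦ (hd.2.2.2.1 x y).1)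
  refine ⟨m, rfl, Metric.complete_of_cauchySeq_tendsto fun x hx ↦ ?_⟩
  obtain ⟨l, hl⟩ := hdc x (Metric.cauchySeq_iff.1 hx)
  exact ⟨l, tendsto_iff_dist_tendsto_zero.2 hl⟩

theorem exists_metric_extensor_complete {X : Type*} [TopologicalSpace X]
    (hcm : ∃ d₀ : X → X → ℝ, IsCompatMetric X d₀ ∧ IsCompleteMetricFun d₀)
    (F : Set X) (hFne : F.Nonempty) (hFcl : IsClosed F)
    (hun : Ultranormal ↥(Fᶜ)) :
    ∃ Ξ : (↥F → ↥F → ℝ) → (X → X → ℝ),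
      (∀ d, IsCompatMetric ↥F d → IsCompatMetric X (Ξ d)) ∧
      -- (1) extension
      (∀ d, IsCompatMetric ↥F d → ∀ a b : ↥F, Ξ d (a : X) (b : X) = d a b) ∧
      -- (2) sup-distance isometry (in [0, ∞])
      (∀ d e, IsCompatMetric ↥F d → IsCompatMetric ↥F e →
        (⨆ x : X, ⨆ y : X, ENNReal.ofReal |Ξ d x y - Ξ e x y|) =
          (⨆ a : ↥F, ⨆ b : ↥F, ENNReal.ofReal |d a b - e a b|)) ∧
      -- (3) monotonicity
      (∀ d e, IsCompatMetric ↥F d → IsCompatMetric ↥F e →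
        (∀ a b : ↥F, d a b ≤ e a b) → ∀ x y : X, Ξ d x y ≤ Ξ e x y) ∧
      -- (4) compatibility with pointwise maxima
      (∀ d e, IsCompatMetric ↥F d → IsCompatMetric ↥F e →
        ∀ x y : X, Ξ (fun a b => max (d a b) (e a b)) x y = max (Ξ d x y) (Ξ e x y)) ∧
      -- preservation of completeness
      (∀ d, IsCompatMetric ↥F d → IsCompleteMetricFun d → IsCompleteMetricFun (Ξ d)) := by
  obtain ⟨d₀, hd₀, hd₀c⟩ := hcm
  obtain ⟨m, rfl, _⟩ := exists_metricSpace_of_isCompatMetric hd₀ hd₀c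
  obtain ⟨r, hrc, hrF, hr⟩ := exists_retraction_dist_le hFne hFcl hun
  have hext : ∀ (d : F → F → ℝ) (a b : F), metricExtension r d a b = d a b := fun d a b ↦ by
    rw [metricExtension, hrF, hrF, collapseDist_of_mem a.2 b.2, add_zero]
  refine ⟨metricExtension r,
    fun d hd ↦ isCompatMetric_metricExtension hFcl hFne hrc hrF hr hd,
    fun d _ ↦ hext d, fun d e _ _ ↦ le_antisymm ?_ ?_,
    fun d e _ _ hde x y ↦ add_le_add_left (hde _ _) _,
    fun d e _ _ x y ↦ (max_add_add_right _ _ _).symm,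
    fun d hd hdc ↦ isCompleteMetricFun_metricExtension hFcl hFne hrc hrF hr hd hdc⟩
  · refine iSup₂_le fun x y ↦ ?_
    simp only [metricExtension, add_sub_add_right_eq_sub]
    exact le_iSup₂ (f := fun a b : F ↦ ENNReal.ofReal |d a b - e a b|) (r x) (r y)
  · refine iSup₂_le fun a b ↦ ?_
    rw [← hext d, ← hext e]
    exact le_iSup₂ (f := fun x y : X ↦
      ENNReal.ofReal |metricExtension r d x y - metricExtension r e x y|) (a : X) (b : X)
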